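/- Let 1≤i≤n−1 and let k∈ℕ^n be the vector with k_ℓ=2 for i≤ℓ≤n−1, k_n=1, and k_ℓ=0 for ℓ<i (the coefficient vector of the root [i,n,i]). For any F∈S_k with numerator f, the Laurent polynomial in w,w′ obtained from f by the substitution x_{ℓ,1}↦v^{1−ℓ}w and x_{ℓ,2}↦v^{1−ℓ}w′ for i≤ℓ≤n−1, and x_{n,1}↦v^{−n}w′, is divisible in ℚ(v)[w^{±1},w′^{±1}] by {(w−v^{−2}w′)(w−v^{2}w′)}^{n−i−1}. -/

import Mathlib

noncomputable section
open scoped BigOperators DirectSum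

/-! ### Base field ℚ(v) and quantum numbers -/

/-- the base field `ℚ(v)`. -/
abbrev KK : Type := RatFunc ℚ
/-- the variable `v ∈ ℚ(v)`. -/
def vv : KK := RatFunc.X
/-- integer powers of `v`. -/
def vpow (m : ℤ) : KK := vv ^ m
/-- the quantum integer `[m]_u = (uᵐ - u⁻ᵐ)/(u - u⁻¹)`. -/
def qInt (u : KK) (m : ℕ) : KK := (u ^ (m : ℤ) - u ^ (-(m : ℤ))) / (u - u⁻¹)
/-- the quantum factorial `[m]_u!`. -/
def qFact (u : KK) (m : ℕ) : KK := ∏ k ∈ Finset.range m, qInt u (k + 1)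
/-- the quantum binomial coefficient. -/
def qBinom (u : KK) (m k : ℕ) : KK := qFact u m / (qFact u k * qFact u (m - k))
/-- `⟨m⟩_v = vᵐ - v⁻ᵐ`. -/
def qBrack (m : ℕ) : KK := vpow (m : ℤ) - vpow (-(m : ℤ))
/-- the sign `ε ∈ {+,-}` as `±1`. -/
def sgn (ε : Bool) : ℤ := if ε then 1 else -1
/-- `l` is an integer power of `v`. -/
def IsVpow (l : KK) : Prop := ∃ m : ℤ, l = vpow m

/-! ### Cartan data of types `C_n` and `D_n` (1-based indices) -/

/-- the Cartan matrix of type `C_n` (1-based indices). -/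
def aC (n i j : ℕ) : ℤ :=
  if i = j then 2 else if i + 1 = n ∧ j = n then -2
  else if i + 1 = j ∨ j + 1 = i then -1 else 0
/-- the symmetrizing integers `d_i` of type `C_n`. -/
def dC (n i : ℕ) : ℕ := if i = n then 2 else 1
/-- the Cartan matrix of type `D_n` (1-based indices). -/
def aD (n i j : ℕ) : ℤ :=
  if i = j then 2
  else if (i + 1 = j ∧ j + 1 ≤ n) ∨ (j + 1 = i ∧ i + 1 ≤ n) then -1
  else if (i + 2 = n ∧ j = n) ∨ (j + 2 = n ∧ i = n) then -1 else 0
/-- the symmetrizing integers `d_i` of type `D_n` (all equal to `1`). -/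
def dD (n i : ℕ) : ℕ := 1

section Shuffle
variable (n : ℕ) (A : ℕ → ℕ → ℤ) (Dd : ℕ → ℕ)

abbrev Vars (k : Fin n → ℕ) : Type := Σ i : Fin n, Fin (k i)
abbrev Pk (k : Fin n → ℕ) := MvPolynomial (Vars n k) KK
abbrev Fk (k : Fin n → ℕ) := FractionRing (Pk n k)

def xvr {k : Fin n → ℕ} (u : Vars n k) : Fk n k := algebraMap (Pk n k) (Fk n k) (MvPolynomial.X u)
def cf {k : Fin n → ℕ} (a : KK) : Fk n k := algebraMap KK (Fk n k) a

def emb1f (k l : Fin n → ℕ) : Vars n k → Vars n (k + l) :=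
  fun u => ⟨u.1, ⟨u.2.1, by have h := u.2.2; show u.2.1 < k u.1 + l u.1; omega⟩⟩
def emb2f (k l : Fin n → ℕ) : Vars n l → Vars n (k + l) :=
  fun u => ⟨u.1, ⟨k u.1 + u.2.1, by have h := u.2.2; show k u.1 + u.2.1 < k u.1 + l u.1; omega⟩⟩

lemma emb1f_inj (k l : Fin n → ℕ) : Function.Injective (emb1f n k l) := by
  rintro ⟨i, r⟩ ⟨j, s⟩ h
  simp only [emb1f, Sigma.mk.inj_iff] at h
  obtain ⟨rfl, h2⟩ := h
  rw [heq_iff_eq, Fin.mk.injEq] at h2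
  exact congrArg _ (Fin.ext h2)

lemma emb2f_inj (k l : Fin n → ℕ) : Function.Injective (emb2f n k l) := by
  rintro ⟨i, r⟩ ⟨j, s⟩ h
  simp only [emb2f, Sigma.mk.inj_iff] at h
  obtain ⟨rfl, h2⟩ := h
  rw [heq_iff_eq, Fin.mk.injEq] at h2
  exact congrArg _ (Fin.ext (by omega))

def permVf {m : Fin n → ℕ} (σ : ∀ i, Equiv.Perm (Fin (m i))) : Vars n m → Vars n m :=
  fun u => ⟨u.1, σ u.1 u.2⟩

lemma permVf_inj {m : Fin n → ℕ} (σ : ∀ i, Equiv.Perm (Fin (m i))) :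
    Function.Injective (permVf n σ) := by
  rintro ⟨i, r⟩ ⟨j, s⟩ h
  simp only [permVf, Sigma.mk.inj_iff] at h
  obtain ⟨rfl, h2⟩ := h
  rw [heq_iff_eq] at h2
  exact congrArg _ ((σ i).injective h2)

/-- extension of an (injective) renaming of variables to fraction fields. -/
def liftHom {k m : Fin n → ℕ} (f : Vars n k → Vars n m) (hf : Function.Injective f) :
    Fk n k →+* Fk n m :=
  IsFractionRing.lift (g := (algebraMap (Pk n m) (Fk n m)).comp
      (MvPolynomial.rename f).toRingHom)
    (by
      rw [RingHom.coe_comp]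
      exact Function.Injective.comp (IsFractionRing.injective _ _)
        (by simpa using MvPolynomial.rename_injective (R := KK) f hf))

def emb1 (k l : Fin n → ℕ) : Fk n k →+* Fk n (k + l) := liftHom n (emb1f n k l) (emb1f_inj n k l)
def emb2 (k l : Fin n → ℕ) : Fk n l →+* Fk n (k + l) := liftHom n (emb2f n k l) (emb2f_inj n k l)
def permF {m : Fin n → ℕ} (σ : ∀ i, Equiv.Perm (Fin (m i))) : Fk n m →+* Fk n m :=
  liftHom n (permVf n σ) (permVf_inj n σ)

/-- the product of `ζ`-factors in the shuffle product. -/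
def zfac (k l : Fin n → ℕ) : Fk n (k + l) :=
  ∏ i : Fin n, ∏ j : Fin n, ∏ r : Fin (k i), ∏ s : Fin (l j),
    (xvr n (emb1f n k l ⟨i, r⟩) -
        cf n (vpow (-((Dd (i.1 + 1) : ℤ) * A (i.1 + 1) (j.1 + 1)))) * xvr n (emb2f n k l ⟨j, s⟩)) /
      (xvr n (emb1f n k l ⟨i, r⟩) - xvr n (emb2f n k l ⟨j, s⟩))

/-- the shuffle product on homogeneous components. -/
def shufMul (k l : Fin n → ℕ) (F : Fk n k) (G : Fk n l) : Fk n (k + l) :=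
  (((∏ i, Nat.factorial (k i)) * (∏ i, Nat.factorial (l i)) : ℕ) : KK)⁻¹ •
    ∑ σ : ∀ i : Fin n, Equiv.Perm (Fin ((k + l) i)),
      permF n σ (emb1 n k l F * emb2 n k l G * zfac n A Dd k l)

abbrev BigS := ⨁ k : Fin n → ℕ, Fk n k

open Classical in
/-- the shuffle product, extended bilinearly to the direct sum. -/
def bstar (x y : BigS n) : BigS n :=
  DFinsupp.sum x fun k xk => DFinsupp.sum y fun l yl =>
    DirectSum.of (fun k => Fk n k) (k + l) (shufMul n A Dd k l xk yl)

def Dpoly (k : Fin n → ℕ) : Pk n k :=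
  ∏ i : Fin n, ∏ j : Fin n,
    if i < j ∧ A (i.1 + 1) (j.1 + 1) ≠ 0 then
      ∏ r : Fin (k i), ∏ s : Fin (k j), (MvPolynomial.X ⟨i, r⟩ - MvPolynomial.X (⟨j, s⟩ : Vars n k))
    else 1

def xProd (k : Fin n → ℕ) : Pk n k := ∏ u : Vars n k, MvPolynomial.X u

/-- `f` is symmetric in the variables of each color. -/
def symmQ {k : Fin n → ℕ} (f : Pk n k) : Prop :=
  ∀ σ : ∀ i, Equiv.Perm (Fin (k i)), MvPolynomial.rename (permVf n σ) f = f

def wheelSub {k : Fin n → ℕ} (i j : Fin n) (m : ℕ) (hm : 0 < m)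
    (s : Fin m → Fin (k i)) (r : Fin (k j)) : Vars n k → Pk n k := fun u =>
  if u = ⟨j, r⟩ then
    MvPolynomial.C (vpow ((Dd (i.1 + 1) : ℤ) * A (i.1 + 1) (j.1 + 1))) *
      MvPolynomial.X ⟨i, s ⟨0, hm⟩⟩
  else if h : ∃ t : Fin m, u = ⟨i, s t⟩ then
    MvPolynomial.C (vpow ((Dd (i.1 + 1) : ℤ) * (-2 * (h.choose.1 : ℤ)))) *
      MvPolynomial.X ⟨i, s ⟨0, hm⟩⟩
  else MvPolynomial.X u

/-- the wheel conditions. -/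
def wheelQ {k : Fin n → ℕ} (f : Pk n k) : Prop :=
  ∀ (i j : Fin n), i ≠ j → ∀ hA : A (i.1 + 1) (j.1 + 1) < 0,
    ∀ s : Fin (1 - A (i.1 + 1) (j.1 + 1)).toNat → Fin (k i), Function.Injective s →
      ∀ r : Fin (k j),
        MvPolynomial.aeval (wheelSub n A Dd i j _ (by omega) s r) f = 0

/-- membership in the component `S_k` of the shuffle algebra: `F = f / (denominator)` with `f`
a symmetric Laurent polynomial satisfying the wheel conditions. -/
def inS {k : Fin n → ℕ} (F : Fk n k) : Prop :=
  ∃ (f : Pk n k) (m : ℕ), symmQ n f ∧ wheelQ n A Dd f ∧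
    F * algebraMap (Pk n k) (Fk n k) (Dpoly n A k * xProd n k ^ m) = algebraMap (Pk n k) (Fk n k) f

end Shuffle

/-- the coefficient vector `k ∈ ℕ^n` of the type-`C_n` root `[i,n,i]`:
`k_ℓ = 2` for `i ≤ ℓ ≤ n-1`, `k_n = 1`, `k_ℓ = 0` otherwise (1-based). -/
def kINI (n i : ℕ) : Fin n → ℕ := fun l =>
  if i ≤ l.1 + 1 ∧ l.1 + 1 ≤ n - 1 then 2 else if l.1 + 1 = n then 1 else 0

/-- the substitution `x_{ℓ,1} ↦ v^{1-ℓ}w`, `x_{ℓ,2} ↦ v^{1-ℓ}w'` (`i ≤ ℓ ≤ n-1`),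
`x_{n,1} ↦ v^{-n}w'`, where `w = X 0` and `w' = X 1`. -/
def subINI (n i : ℕ) : Vars n (kINI n i) → MvPolynomial (Fin 2) KK := fun u =>
  if u.1.1 + 1 = n then MvPolynomial.C (vpow (-(n : ℤ))) * MvPolynomial.X 1
  else if u.2.1 = 0 then MvPolynomial.C (vpow (1 - (u.1.1 + 1 : ℤ))) * MvPolynomial.X 0
  else MvPolynomial.C (vpow (1 - (u.1.1 + 1 : ℤ))) * MvPolynomial.X 1

lemma vv_ne_zero : vv ≠ 0 := RatFunc.X_ne_zero

lemma vpow_add (a b : ℤ) : vpow (a + b) = vpow a * vpow b := zpow_add₀ vv_ne_zero a b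

lemma vpow_ne_zero (a : ℤ) : vpow a ≠ 0 := zpow_ne_zero a vv_ne_zero

lemma vpow_neg_four_ne_one : vpow (-4) ≠ 1 := by
  intro h
  have h4 : vv ^ 4 = 1 := by
    have := vpow_add (-4) 4
    rw [h, one_mul] at this
    have h0 : vpow ((-4 : ℤ) + 4) = 1 := by simp [vpow]
    rw [h0] at this
    exact this.symm
  have h5 : algebraMap (Polynomial ℚ) (RatFunc ℚ) (Polynomial.X ^ 4) =
      algebraMap (Polynomial ℚ) (RatFunc ℚ) 1 := by
    simpa [vv, RatFunc.algebraMap_X] using h4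
  have h6 := congrArg Polynomial.natDegree (RatFunc.algebraMap_injective ℚ h5)
  simp at h6

section Substitution
variable {σ R : Type*} [CommRing R] [DecidableEq σ]

/-- Substituting `p` for the variable `X j` changes a polynomial by a multiple of `X j - p`. -/
lemma X_sub_dvd_sub_aeval_update (j : σ) (p h : MvPolynomial σ R) :
    MvPolynomial.X j - p ∣ h - MvPolynomial.aeval (Function.update MvPolynomial.X j p) h := by
  rw [← Ideal.mem_span_singleton, ← Ideal.Quotient.mk_eq_mk_iff_sub_mem]
  have key : Ideal.Quotient.mkₐ R (Ideal.span {MvPolynomial.X j - p}) =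
      (Ideal.Quotient.mkₐ R (Ideal.span {MvPolynomial.X j - p})).comp
        (MvPolynomial.aeval (Function.update MvPolynomial.X j p)) := by
    ext k
    by_cases hk : k = j
    · subst hk
      simp [Ideal.Quotient.mk_eq_mk_iff_sub_mem]
    · simp [Function.update_of_ne hk]
  exact DFunLike.congr_fun key h

/-- If `p` does not involve `X j`, then `X j - p` divides exactly the polynomials vanishing
under the substitution `X j ↦ p`. -/
lemma X_sub_dvd_iff {j : σ} {p : MvPolynomial σ R}
    (hp : MvPolynomial.aeval (Function.update MvPolynomial.X j p) p = p)
    (h : MvPolynomial σ R) :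
    MvPolynomial.X j - p ∣ h ↔
      MvPolynomial.aeval (Function.update MvPolynomial.X j p) h = 0 := by
  constructor
  · rintro ⟨g, rfl⟩
    rw [map_mul, map_sub, hp, MvPolynomial.aeval_X, Function.update_self, sub_self, zero_mul]
  · intro h0
    have := X_sub_dvd_sub_aeval_update j p h
    rwa [h0, sub_zero] at this

lemma X_sub_prime [IsDomain R] {j : σ} {p : MvPolynomial σ R}
    (hp : MvPolynomial.aeval (Function.update MvPolynomial.X j p) p = p)
    (hne : MvPolynomial.X j - p ≠ 0) : Prime (MvPolynomial.X j - p) := by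
  refine ⟨hne, fun hu => ?_, fun a b hab => ?_⟩
  · have := (X_sub_dvd_iff hp 1).1 hu.dvd
    simp at this
  · simpa only [X_sub_dvd_iff hp, map_mul, mul_eq_zero] using hab

end Substitution

section LinearForms
variable {σ K : Type*} [Field K] [DecidableEq σ]

lemma aeval_update_C_mul_X {j k : σ} (hjk : k ≠ j) (q : MvPolynomial σ K) (c : K) :
    MvPolynomial.aeval (Function.update MvPolynomial.X j q)
      (MvPolynomial.C c * MvPolynomial.X k) = MvPolynomial.C c * MvPolynomial.X k := by
  simp [Function.update_of_ne hjk, MvPolynomial.algebraMap_eq]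

lemma X_sub_C_mul_X_prime {j k : σ} (hjk : k ≠ j) (c : K) :
    Prime (MvPolynomial.X j - MvPolynomial.C c * MvPolynomial.X k : MvPolynomial σ K) := by
  refine X_sub_prime (aeval_update_C_mul_X hjk _ c) fun h => ?_
  have := congrArg (MvPolynomial.eval (Pi.single j 1)) h
  simp [hjk] at this

lemma X_sub_C_mul_X_isRelPrime {j k o : σ} (hj : o ≠ j) (hk : o ≠ k) (hjk : j ≠ k) (c d : K) :
    IsRelPrime (MvPolynomial.X j - MvPolynomial.C c * MvPolynomial.X o : MvPolynomial σ K)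
      (MvPolynomial.X k - MvPolynomial.C d * MvPolynomial.X o) := by
  rw [(X_sub_C_mul_X_prime hj c).irreducible.isRelPrime_iff_not_dvd,
    X_sub_dvd_iff (aeval_update_C_mul_X hj _ c)]
  intro h
  have := congrArg (MvPolynomial.eval (Pi.single k 1)) h
  simp [Function.update_of_ne hjk.symm, Function.update_of_ne hj, hk] at this

/-- Two linear forms `X j - c X k` and `X k - c X j` with `c² ≠ 1` have no common factor. -/
lemma isRelPrime_swap {j k : σ} (hjk : j ≠ k) {c : K} (hc : c * c ≠ 1) :
    IsRelPrime (MvPolynomial.X j - MvPolynomial.C c * MvPolynomial.X k : MvPolynomial σ K)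
      (MvPolynomial.X k - MvPolynomial.C c * MvPolynomial.X j) := by
  rw [(X_sub_C_mul_X_prime hjk.symm c).irreducible.isRelPrime_iff_not_dvd,
    X_sub_dvd_iff (aeval_update_C_mul_X hjk.symm _ c)]
  intro h
  have := congrArg (MvPolynomial.eval (Pi.single k 1)) h
  simp [Function.update_of_ne hjk.symm, MvPolynomial.algebraMap_eq] at this
  exact hc (sub_eq_zero.1 this).symm

end LinearForms

/-- A polynomial satisfying the wheel conditions vanishes under every substitution obeying the
relations `x_{i,a} = v² x_{i,b} = v x_{j,r}` for neighbours `i`, `j` with `a_{ij} = -1`. -/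
lemma aeval_eq_zero_of_wheelQ {n : ℕ} {A : ℕ → ℕ → ℤ} {Dd : ℕ → ℕ} {k : Fin n → ℕ}
    {f : Pk n k} (hf : wheelQ n A Dd f) {R : Type*} [CommRing R] [Algebra KK R]
    (φ : Vars n k → R) {i j : Fin n} (hij : i ≠ j) (hA : A (i.1 + 1) (j.1 + 1) = -1)
    (hd : Dd (i.1 + 1) = 1) {a b : Fin (k i)} (hab : a ≠ b) (r : Fin (k j))
    (hb : φ ⟨i, b⟩ = algebraMap KK R (vpow (-2)) * φ ⟨i, a⟩)
    (hr : φ ⟨j, r⟩ = algebraMap KK R (vpow (-1)) * φ ⟨i, a⟩) :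
    MvPolynomial.aeval φ f = 0 := by
  have hlt : ∀ t : Fin (1 - A (i.1 + 1) (j.1 + 1)).toNat, t.1 = 0 ∨ t.1 = 1 := by
    intro t
    have := t.2
    omega
  have hneg : A (i.1 + 1) (j.1 + 1) < 0 := by omega
  let s : Fin (1 - A (i.1 + 1) (j.1 + 1)).toNat → Fin (k i) := fun t => if t.1 = 0 then a else b
  have hs : Function.Injective s := by
    intro t t' h
    rcases hlt t with h1 | h1 <;> rcases hlt t' with h2 | h2 <;>
      simp [s, h1, h2, hab, hab.symm] at h <;> exact Fin.ext (h1.trans h2.symm)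
  have key := congrArg (MvPolynomial.aeval φ) (hf i j hij hneg s hs r)
  rw [map_zero, ← AlgHom.comp_apply] at key
  rw [← key]
  congr 1
  ext u
  simp only [AlgHom.comp_apply, MvPolynomial.aeval_X]
  unfold wheelSub
  split_ifs with h1 h2
  · subst h1
    simp [s, hA, hd, hr]
  · have hu := h2.choose_spec
    rcases hlt h2.choose with h3 | h3
    · rw [h3]
      simp only [s, h3] at hu
      rw [hu]
      simp [s, vpow]
    · rw [h3]
      simp only [s, h3] at hu
      rw [hu]
      simp [s, hd, hb]
  · simp

/-- The substitution freezing one variable `x_{ℓ,b+1} = v^{1-ℓ} w` of each color `ℓ < n`, where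
`w = X none`, and keeping the other variable of that color free. -/
def halfSub (n i b : ℕ) : Vars n (kINI n i) → MvPolynomial (Option (Fin n)) KK := fun u =>
  if u.1.1 + 1 = n then MvPolynomial.X (some u.1)
  else if u.2.1 = b then
    MvPolynomial.C (vpow (1 - (u.1.1 + 1 : ℤ))) * MvPolynomial.X none
  else MvPolynomial.X (some u.1)

/-- The substitution of the remaining variables that completes `halfSub` to `subINI`. -/
def restSub (n : ℕ) (b : Fin 2) : Option (Fin n) → MvPolynomial (Fin 2) KK
  | none => MvPolynomial.X b
  | some j =>
    if j.1 + 1 = n then MvPolynomial.C (vpow (-(n : ℤ))) * MvPolynomial.X 1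
    else MvPolynomial.C (vpow (1 - (j.1 + 1 : ℤ))) * MvPolynomial.X (1 - b)

lemma kINI_eq_two {n i : ℕ} {j : Fin n} (h : i ≤ j.1 + 1) (h' : j.1 + 1 ≤ n - 1) :
    kINI n i j = 2 := by simp [kINI, h, h']

lemma kINI_le_two (n i : ℕ) (j : Fin n) : kINI n i j ≤ 2 := by
  unfold kINI
  split_ifs <;> omega

lemma aeval_restSub_halfSub (n i : ℕ) (b : Fin 2) (f : Pk n (kINI n i)) :
    MvPolynomial.aeval (restSub n b) (MvPolynomial.aeval (halfSub n i b.1) f) =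
      MvPolynomial.aeval (subINI n i) f := by
  rw [← AlgHom.comp_apply]
  congr 1
  ext1 u
  have hu : u.2.1 = 0 ∨ u.2.1 = 1 := by
    have := u.2.2
    have := kINI_le_two n i u.1
    omega
  simp only [AlgHom.comp_apply, MvPolynomial.aeval_X, halfSub, subINI]
  by_cases h : u.1.1 + 1 = n
  · simp [h, restSub]
  · fin_cases b <;> rcases hu with hu | hu <;>
      simp [h, hu, restSub, MvPolynomial.algebraMap_eq]

lemma prod_dvd_aeval_halfSub {n i b : ℕ} (hb : b < 2) {f : Pk n (kINI n i)}
    (hwheel : wheelQ n (aC n) (dC n) f) :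
    ∏ j : Fin n with i ≤ j.1 + 1 ∧ j.1 + 2 < n,
      (MvPolynomial.X (some j) - MvPolynomial.C (vpow (-2) * vpow (1 - (j.1 + 1 : ℤ))) *
        MvPolynomial.X none : MvPolynomial (Option (Fin n)) KK) ∣
      MvPolynomial.aeval (halfSub n i b) f := by
  refine Finset.prod_dvd_of_isRelPrime (fun j _ k _ hjk => X_sub_C_mul_X_isRelPrime (by simp)
    (by simp) (by simpa using hjk) _ _) fun j hj => ?_
  obtain ⟨h1, h2⟩ := (Finset.mem_filter.1 hj).2
  rw [X_sub_dvd_iff (aeval_update_C_mul_X (by simp) _ _), ← AlgHom.comp_apply,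
    MvPolynomial.comp_aeval]
  have hk : kINI n i j = 2 := kINI_eq_two h1 (by omega)
  have hk' : kINI n i ⟨j.1 + 1, by omega⟩ = 2 :=
    kINI_eq_two (by simp only; omega) (by simp only; omega)
  have hn : j.1 + 1 ≠ n := by omega
  have hn' : j.1 + 1 + 1 ≠ n := by omega
  refine aeval_eq_zero_of_wheelQ hwheel _ (i := j) (j := ⟨j.1 + 1, by omega⟩)
    (a := ⟨b, by omega⟩) (b := ⟨1 - b, by omega⟩) ?_ ?_ ?_ ?_ ⟨b, by omega⟩ ?_ ?_
  · simp [Fin.ext_iff]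
  · simp [aC, hn']
  · simp [dC, hn]
  · simp only [ne_eq, Fin.mk.injEq]
    omega
  · have hb' : 1 - b ≠ b := by omega
    simp [halfSub, hn, hb', MvPolynomial.algebraMap_eq, mul_assoc]
  · have hv : vpow (1 - (((j.1 + 1 : ℕ) : ℤ) + 1)) = vpow (-1) * vpow (1 - (j.1 + 1 : ℤ)) := by
      rw [← vpow_add]
      congr 1
      push_cast
      ring
    simp only [halfSub, hn, hn', if_false, if_true, hv]
    simp [MvPolynomial.algebraMap_eq, mul_assoc]

lemma card_filter_colors {n i : ℕ} (hi : 1 ≤ i) :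
    (Finset.univ.filter fun j : Fin n => i ≤ j.1 + 1 ∧ j.1 + 2 < n).card = n - i - 1 := by
  rw [← Finset.card_map Fin.valEmbedding]
  trans (Finset.Ico (i - 1) (n - 2)).card
  · congr 1
    ext x
    simp only [Finset.mem_map, Finset.mem_filter, Finset.mem_univ, true_and,
      Fin.valEmbedding_apply, Finset.mem_Ico]
    constructor
    · rintro ⟨j, hj, rfl⟩
      omega
    · intro hx
      exact ⟨⟨x, by omega⟩, by simp only; omega, rfl⟩
  · rw [Nat.card_Ico]
    omega

lemma pow_dvd_aeval_subINI {n i : ℕ} (hi : 1 ≤ i) (b : Fin 2) {f : Pk n (kINI n i)}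
    (hwheel : wheelQ n (aC n) (dC n) f) :
    (MvPolynomial.X (1 - b) - MvPolynomial.C (vpow (-2)) * MvPolynomial.X b :
      MvPolynomial (Fin 2) KK) ^ (n - i - 1) ∣ MvPolynomial.aeval (subINI n i) f := by
  rw [← aeval_restSub_halfSub n i b f]
  refine dvd_trans ?_ (map_dvd (MvPolynomial.aeval (restSub n b))
    (prod_dvd_aeval_halfSub b.2 hwheel))
  rw [map_prod, ← card_filter_colors hi, ← Finset.prod_const]
  refine Finset.prod_dvd_prod_of_dvd _ _ fun j hj => ⟨MvPolynomial.C (vpow (1 - (j.1 + 1 : ℤ))), ?_⟩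
  have hn : j.1 + 1 ≠ n := by
    have := (Finset.mem_filter.1 hj).2
    omega
  simp only [map_sub, map_mul, MvPolynomial.aeval_X, MvPolynomial.aeval_C, restSub, hn, if_false,
    MvPolynomial.algebraMap_eq]
  ring

/-- **Divisibility from the wheel conditions (type `C_n`)**: let `1 ≤ i ≤ n-1` and let `k`
be the coefficient vector of `[i,n,i]`.  For any `F ∈ S_k` with numerator `f`, the image of
`f` under the substitution `x_{ℓ,1} ↦ v^{1-ℓ}w`, `x_{ℓ,2} ↦ v^{1-ℓ}w'`, `x_{n,1} ↦ v^{-n}w'`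
is divisible in `ℚ(v)[w^{±1},w'^{±1}]` by `{(w - v⁻²w')(w - v²w')}^{n-i-1}`. -/
theorem wheel_divisibility_typeC (n : ℕ) (hn : 2 ≤ n) (i : ℕ) (hi : 1 ≤ i ∧ i ≤ n - 1)
    (f : Pk n (kINI n i)) (hsym : symmQ n f) (hwheel : wheelQ n (aC n) (dC n) f) :
    ∃ (g : MvPolynomial (Fin 2) KK) (a b : ℕ),
      MvPolynomial.X 0 ^ a * MvPolynomial.X 1 ^ b * MvPolynomial.aeval (subINI n i) f =
        ((MvPolynomial.X 0 - MvPolynomial.C (vpow (-2)) * MvPolynomial.X 1) *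
          (MvPolynomial.X 0 - MvPolynomial.C (vpow 2) * MvPolynomial.X 1)) ^ (n - i - 1) * g := by
  have h0 := pow_dvd_aeval_subINI hi.1 0 hwheel
  have h1 := pow_dvd_aeval_subINI hi.1 1 hwheel
  have hc : vpow (-2) * vpow (-2) ≠ 1 := by
    rw [← vpow_add]
    exact vpow_neg_four_ne_one
  obtain ⟨g, hg⟩ := ((isRelPrime_swap (K := KK) (zero_ne_one (α := Fin 2)) hc).pow).mul_dvd h1 h0
  refine ⟨MvPolynomial.C (-vpow (-2)) ^ (n - i - 1) * g, 0, 0, ?_⟩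
  have hv : (MvPolynomial.C (vpow (-2)) * MvPolynomial.C (vpow 2) : MvPolynomial (Fin 2) KK) = 1 := by
    rw [← MvPolynomial.C_mul, ← vpow_add]
    simp [vpow]
  have hlin : (MvPolynomial.X 1 - MvPolynomial.C (vpow (-2)) * MvPolynomial.X 0 :
      MvPolynomial (Fin 2) KK) =
      (MvPolynomial.X 0 - MvPolynomial.C (vpow 2) * MvPolynomial.X 1) *
        MvPolynomial.C (-vpow (-2)) := by
    rw [MvPolynomial.C_neg]
    linear_combination (-MvPolynomial.X 1 : MvPolynomial (Fin 2) KK) * hv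
  rw [hg, hlin]
  simp only [pow_zero, one_mul, mul_pow]
  ring
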